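/- arXiv:2104.12800 — 3 statements merged into one kernel-verified Lean document; each statement's English description precedes it below -/
import Mathlib

section
/- Let k ≥ 3 be odd, let 1 ≤ t < k with t even, and let t < d < k with d even and d + t ≤ k. Let x ∈ {0,1}^k be a tuple of Hamming weight d. Then the template (In_t^k ∪ {x}, NAE) does not have 2-block-symmetric polymorphisms of all odd arities; that is, there exists an odd m ≥ 1 such that no 2-block-symmetric function f : {0,1}^m → {0,1} is a polymorphism of (In_t^k ∪ {x}, NAE). -/
/-- Hamming weight of a Boolean tuple. -/
def wt {k : ℕ} (v : Fin k → Bool) : ℕ :=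
  (Finset.univ.filter (fun i => v i = true)).card

/-- The set of `k`-tuples of Hamming weight exactly `t`. -/
def InT (k t : ℕ) : Set (Fin k → Bool) := {v | wt v = t}

/-- Not-all-equal: all tuples except all-zeros and all-ones. -/
def NAE (k : ℕ) : Set (Fin k → Bool) :=
  {v | v ≠ (fun _ => false) ∧ v ≠ (fun _ => true)}

/-- `f` is a polymorphism of the template `(R, S)`. -/
def IsPolymorphism {k m : ℕ} (R S : Set (Fin k → Bool)) (f : (Fin m → Bool) → Bool) : Prop :=
  ∀ v : Fin m → Fin k → Bool, (∀ j, v j ∈ R) → (fun i => f (fun j => v j i)) ∈ S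

/-- `f` is 2-block-symmetric: invariant under permutations preserving the parity
of coordinate positions. -/
def TwoBlockSym {m : ℕ} (f : (Fin m → Bool) → Bool) : Prop :=
  ∀ π : Equiv.Perm (Fin m), (∀ i, ((π i : ℕ)) % 2 = (i : ℕ) % 2) →
    ∀ x : Fin m → Bool, f (fun i => x (π i)) = f x

/-- `c` is the vector of row sums of a matrix whose `N` columns are all in `R`. -/
def Realizable {k : ℕ} (R : Set (Fin k → Bool)) (N : ℕ) (c : Fin k → ℕ) : Prop :=
  ∃ v : Fin N → Fin k → Bool, (∀ j, v j ∈ R) ∧ ∀ i, wt (fun j => v j i) = c i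

lemma wt_eq_sum {k : ℕ} (v : Fin k → Bool) : wt v = ∑ i, if v i = true then 1 else 0 := by
  simp [wt]

lemma Realizable.mono {k N : ℕ} {R S : Set (Fin k → Bool)} {c : Fin k → ℕ}
    (h : Realizable R N c) (hRS : R ⊆ S) : Realizable S N c := by
  obtain ⟨v, hv, hc⟩ := h
  exact ⟨v, fun j => hRS (hv j), hc⟩

lemma Realizable.cons {k N : ℕ} {R : Set (Fin k → Bool)} {c : Fin k → ℕ}
    (h : Realizable R N c) {x : Fin k → Bool} (hx : x ∈ R) :
    Realizable R (N + 1) (fun i => c i + if x i = true then 1 else 0) := by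
  obtain ⟨v, hv, hc⟩ := h
  refine ⟨Fin.cons x v, fun j => ?_, fun i => ?_⟩
  · refine Fin.cases ?_ (fun j => ?_) j
    · simpa using hx
    · simpa using hv j
  · dsimp only
    rw [← hc i, wt_eq_sum, wt_eq_sum, Fin.sum_univ_succ]
    simp [add_comm]

lemma Realizable.add_copies {k N : ℕ} {R : Set (Fin k → Bool)} {c : Fin k → ℕ}
    (h : Realizable R N c) {x : Fin k → Bool} (hx : x ∈ R) (p : ℕ) :
    Realizable R (N + p) (fun i => c i + if x i = true then p else 0) := by
  induction p with
  | zero => simpa using h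
  | succ p ih =>
    have h := ih.cons hx
    rw [← Nat.add_assoc]
    convert h using 2 with i
    split_ifs <;> omega

/-- Any row sums bounded by `N` and adding up to `t * N` come from `N` columns of weight `t`. -/
lemma realizable_inT {k t : ℕ} (N : ℕ) (c : Fin k → ℕ) (hc : ∀ i, c i ≤ N)
    (hsum : ∑ i, c i = t * N) : Realizable (InT k t) N c := by
  induction N generalizing c with
  | zero =>
    refine ⟨Fin.elim0, fun j => j.elim0, fun i => ?_⟩
    have := hc i
    simp only [wt_eq_sum, Finset.univ_eq_empty, Finset.sum_empty]
    omega
  | succ N ih =>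
    have hfull : (Finset.univ.filter fun i => c i = N + 1).card ≤ t := by
      have h : (Finset.univ.filter fun i => c i = N + 1).card * (N + 1) ≤ ∑ i, c i := by
        rw [Finset.card_eq_sum_ones, Finset.sum_mul, Finset.sum_filter]
        refine Finset.sum_le_sum fun i _ => ?_
        split_ifs <;> omega
      rw [hsum] at h
      exact Nat.le_of_mul_le_mul_right h N.succ_pos
    have hpos : t ≤ (Finset.univ.filter fun i => 0 < c i).card := by
      have h : ∑ i, c i ≤ (Finset.univ.filter fun i => 0 < c i).card * (N + 1) := by
        rw [Finset.card_eq_sum_ones, Finset.sum_mul, Finset.sum_filter]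
        refine Finset.sum_le_sum fun i _ => ?_
        have := hc i
        split_ifs <;> omega
      rw [hsum] at h
      exact Nat.le_of_mul_le_mul_right h N.succ_pos
    have hsub : (Finset.univ.filter fun i => c i = N + 1) ⊆
        Finset.univ.filter fun i => 0 < c i := by
      intro i
      simp only [Finset.mem_filter, Finset.mem_univ, true_and]
      omega
    obtain ⟨T, hT₁, hT₂, hT⟩ := Finset.exists_subsuperset_card_eq hsub hfull hpos
    have hfullT : ∀ i, c i = N + 1 → i ∈ T := fun i hi => hT₁ (by simpa using hi)
    have hposT : ∀ i, i ∈ T → 0 < c i := fun i hi => by simpa using hT₂ hi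
    have hsplit : ∀ i, c i = (c i - if i ∈ T then 1 else 0) + if i ∈ T then 1 else 0 := by
      intro i
      have := hposT i
      split_ifs with hi
      · have := hposT i hi
        omega
      · omega
    have hrec : Realizable (InT k t) N (fun i => c i - if i ∈ T then 1 else 0) := by
      refine ih _ (fun i => ?_) ?_
      · have h₁ := hc i
        have h₂ := hfullT i
        split_ifs with hi
        · omega
        · have : c i ≠ N + 1 := fun h => hi (h₂ h)
          omega
      · have h : ∑ i, c i = ∑ i, (c i - if i ∈ T then 1 else 0) + T.card := by
          rw [Finset.sum_congr rfl fun i _ => hsplit i, Finset.sum_add_distrib]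
          simp
        rw [hsum, hT, Nat.mul_succ] at h
        omega
    have hmem : (fun i => decide (i ∈ T)) ∈ InT k t := by
      simpa [InT, wt] using hT
    convert hrec.cons hmem using 2 with i
    simpa using hsplit i

/-- Boolean tuples of equal weight differ by a permutation of the coordinates. -/
lemma exists_perm_of_wt_eq {n : ℕ} (A B : Fin n → Bool) (h : wt A = wt B) :
    ∃ σ : Equiv.Perm (Fin n), ∀ i, B (σ i) = A i := by
  have hcard : ∀ b, Fintype.card {i // A i = b} = Fintype.card {i // B i = b} := by
    have htrue : Fintype.card {i // A i = true} = Fintype.card {i // B i = true} := by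
      simpa [Fintype.card_subtype, wt] using h
    rintro (_ | _)
    · have hA := Fintype.card_subtype_compl fun i => A i = true
      have hB := Fintype.card_subtype_compl fun i => B i = true
      simp only [Bool.not_eq_true] at hA hB
      rw [hA, hB, htrue]
    · exact htrue
  exact ⟨Equiv.ofFiberEquiv fun b => Fintype.equivOfCardEq (hcard b),
    fun i => Equiv.ofFiberEquiv_map _ i⟩

/-- The two blocks of positions of a tuple of length `2 * n + 1`. -/
def blockEquiv (n : ℕ) : Fin (n + 1) ⊕ Fin n ≃ Fin (2 * n + 1) where
  toFun := Sum.elim (fun a => ⟨2 * a, by omega⟩) (fun b => ⟨2 * b + 1, by omega⟩)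
  invFun i := if h : (i : ℕ) % 2 = 0 then Sum.inl ⟨i / 2, by omega⟩ else Sum.inr ⟨i / 2, by omega⟩
  left_inv := by
    rintro (a | b)
    · simp
    · have : (2 * (b : ℕ) + 1) / 2 = b := by omega
      simp [Nat.add_mod, this]
  right_inv i := by
    dsimp only
    split_ifs with h
    · ext
      simp only [Sum.elim_inl]
      omega
    · ext
      simp only [Sum.elim_inr]
      omega

/-- The value of a 2-block-symmetric function depends only on the weights of the blocks. -/
lemma TwoBlockSym.congr_wt {n : ℕ} {f : (Fin (2 * n + 1) → Bool) → Bool} (hf : TwoBlockSym f)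
    {A A' : Fin (n + 1) → Bool} {B B' : Fin n → Bool} (hA : wt A = wt A') (hB : wt B = wt B') :
    f (Sum.elim A B ∘ (blockEquiv n).symm) = f (Sum.elim A' B' ∘ (blockEquiv n).symm) := by
  obtain ⟨σ, hσ⟩ := exists_perm_of_wt_eq A' A hA.symm
  obtain ⟨τ, hτ⟩ := exists_perm_of_wt_eq B' B hB.symm
  rw [← hf ((blockEquiv n).permCongr (Equiv.sumCongr σ τ)) ?_]
  · congr 1
    ext i
    obtain ⟨s, rfl⟩ := (blockEquiv n).surjective i
    rcases s with a | b <;> simp [Equiv.permCongr_apply, hσ, hτ]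
  · intro i
    obtain ⟨s, rfl⟩ := (blockEquiv n).surjective i
    rcases s with a | b <;> simp [Equiv.permCongr_apply, blockEquiv, Nat.add_mod]

/-- With the second block balanced, a 2-block-symmetric polymorphism to `NAE` colours the possible
row sums of the first block so that no realizable vector of row sums is monochromatic. -/
lemma exists_coloring {k n b : ℕ} {R : Set (Fin k → Bool)} {f : (Fin (2 * n + 1) → Bool) → Bool}
    (hf : TwoBlockSym f) (hpol : IsPolymorphism R (NAE k) f)
    (hb : Realizable R n (fun _ => b)) :
    ∃ G : ℕ → Bool, ∀ c, Realizable R (n + 1) c → ∀ z, ∃ i, G (c i) ≠ z := by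
  classical
  refine ⟨fun a => decide (∃ A B, wt A = a ∧ wt B = b ∧
    f (Sum.elim A B ∘ (blockEquiv n).symm) = true), ?_⟩
  rintro c ⟨v, hv, hvc⟩ z
  obtain ⟨w, hw, hwb⟩ := hb
  have hG : ∀ i, decide (∃ A B, wt A = c i ∧ wt B = b ∧
      f (Sum.elim A B ∘ (blockEquiv n).symm) = true) =
      f (fun j => Sum.elim v w ((blockEquiv n).symm j) i) := by
    intro i
    have heq : (fun j => Sum.elim v w ((blockEquiv n).symm j) i) =
        Sum.elim (fun j => v j i) (fun j => w j i) ∘ (blockEquiv n).symm := by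
      ext j
      rcases h : (blockEquiv n).symm j with a | a <;> simp [h]
    rw [heq, Bool.eq_iff_iff, decide_eq_true_iff]
    constructor
    · rintro ⟨A, B, hA, hB, h⟩
      rwa [hf.congr_wt (hA.trans (hvc i).symm) (hB.trans (hwb i).symm)] at h
    · exact fun h => ⟨_, _, hvc i, hwb i, h⟩
  have hnae := hpol (fun j => Sum.elim v w ((blockEquiv n).symm j)) fun j => by
    rcases (blockEquiv n).symm j with a | a
    · exact hv a
    · exact hw a
  by_contra! hall
  simp only [hG] at hall
  cases z
  · exact hnae.1 (funext hall)
  · exact hnae.2 (funext hall)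

lemma sum_two_valued {k : ℕ} (T : Finset (Fin k)) (u e : ℕ) :
    ∑ i, (u + if i ∈ T then e else 0) = k * u + T.card * e := by
  simp [Finset.sum_add_distrib]

theorem stmt_9 {k t d : ℕ} (hk : 3 ≤ k) (hkodd : Odd k)
    (ht : 1 ≤ t) (htk : t < k) (hteven : Even t)
    (htd : t < d) (hdk : d < k) (hdeven : Even d) (hsum : d + t ≤ k)
    (x : Fin k → Bool) (hx : wt x = d) :
    ∃ m : ℕ, Odd m ∧ 1 ≤ m ∧ ∀ f : (Fin m → Bool) → Bool,
      TwoBlockSym f → ¬ IsPolymorphism (InT k t ∪ {x}) (NAE k) f := by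
  refine ⟨2 * (k * (k + 1)) + 1, odd_two_mul_add_one _, by omega, fun f hf hpol => ?_⟩
  set R := InT k t ∪ {x} with hR
  set u := t * (k + 1) with hu
  have hroom : u + (k + 1) ≤ k * (k + 1) := by nlinarith
  have huk : k + 1 ≤ u := by nlinarith
  have hInT : InT k t ⊆ R := Set.subset_union_left
  obtain ⟨G, hG⟩ := exists_coloring (b := u) hf hpol
    ((realizable_inT _ _ (fun _ => by omega) (by simp [hu]; ring)).mono hInT)
  have hsubset : ∀ s ≤ k, ∃ T : Finset (Fin k), T.card = s := fun s hs => by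
    obtain ⟨T, -, hT⟩ := Finset.exists_subset_card_eq
      (s := (Finset.univ : Finset (Fin k))) (n := s) (by simpa using hs)
    exact ⟨T, hT⟩
  have hmix : ∀ (a e : ℕ) (T : Finset (Fin k)), G a = G (a + e) →
      ¬ Realizable R (k * (k + 1) + 1) (fun i => a + if i ∈ T then e else 0) := by
    intro a e T hGe hreal
    obtain ⟨i, hi⟩ := hG _ hreal (G a)
    split_ifs at hi
    · exact hi hGe.symm
    · exact hi rfl
  have h₀₁ : G u ≠ G (u + 1) := by
    intro h
    obtain ⟨T, hT⟩ := hsubset t htk.le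
    refine hmix u 1 T h ((realizable_inT _ _ (fun i => ?_) ?_).mono hInT)
    · split_ifs <;> omega
    · rw [sum_two_valued, hT, hu]
      ring
  have h₀₂ : G u ≠ G (u + 2) := by
    intro h
    obtain ⟨s, hs⟩ := hteven
    obtain ⟨T, hT⟩ := hsubset s (by omega)
    refine hmix u 2 T h ((realizable_inT _ _ (fun i => ?_) ?_).mono hInT)
    · split_ifs <;> omega
    · rw [sum_two_valued, hT, hu]
      have : s * 2 = t := by omega
      rw [this]
      ring
  have h₁₂ : G (u + 1) = G (u + 1 + 1) := by
    revert h₀₁ h₀₂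
    cases G u <;> cases G (u + 1) <;> cases G (u + 2) <;> simp
  obtain ⟨D, rfl⟩ : ∃ D, d = t + D := ⟨d - t, by omega⟩
  obtain ⟨p, j, hpk, hjk, hpj⟩ : ∃ p j, p ≤ k ∧ j ≤ k ∧ k + j = t + D * p := by
    have hD : 0 < D := by omega
    have h₁ := Nat.div_add_mod (k - t) D
    have h₂ := Nat.mod_lt (k - t) hD
    have h₃ := Nat.div_le_self (k - t) D
    have h₄ : D * ((k - t) / D + 1) = D * ((k - t) / D) + D := by ring
    exact ⟨(k - t) / D + 1, t + D * ((k - t) / D + 1) - k, by omega, by omega, by omega⟩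
  obtain ⟨T, hT⟩ := hsubset j hjk
  obtain ⟨q, hq⟩ : ∃ q, k * (k + 1) + 1 = q + p := ⟨k * (k + 1) + 1 - p, by omega⟩
  have hsplit : ∀ i, (u + 1 + if i ∈ T then 1 else 0) =
      ((u + 1 + if i ∈ T then 1 else 0) - if x i = true then p else 0) +
        if x i = true then p else 0 := by
    intro i
    split_ifs <;> omega
  refine hmix (u + 1) 1 T h₁₂ ?_
  rw [hq]
  have hreal : Realizable R q
      (fun i => (u + 1 + if i ∈ T then 1 else 0) - if x i = true then p else 0) := by
    refine (realizable_inT _ _ (fun i => ?_) ?_).mono hInT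
    · split_ifs <;> omega
    · have hxp : ∑ i, (if x i = true then p else 0) = (t + D) * p := by
        rw [← hx, wt_eq_sum, Finset.sum_mul]
        simp
      have h := sum_two_valued T (u + 1) 1
      rw [Finset.sum_congr rfl fun i _ => hsplit i, Finset.sum_add_distrib, hxp, hT] at h
      have hqt : t * (k * (k + 1) + 1) = t * q + t * p := by rw [hq]; ring
      rw [hu] at h ⊢
      nlinarith
  convert hreal.add_copies (x := x) (by simp [hR]) p using 2 with i
  exact hsplit i
end

section
/- Let k ≥ 4 be even and let t be odd with 1 ≤ t < k. Let T ⊆ {0,1}^k be any set that contains all k-tuples of Hamming weight exactly t and is closed under componentwise XOR of triples (if u, v, w ∈ T then the tuple whose i-th coordinate is u_i + v_i + w_i mod 2 is in T). Then T contains every k-tuple of odd Hamming weight. -/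
lemma wt_decide_mem {k : ℕ} (A : Finset (Fin k)) : wt (fun i => decide (i ∈ A)) = A.card := by
  simp [wt]

lemma wt_add_wt {k : ℕ} (x z : Fin k → Bool) :
    wt x + wt z = (Finset.univ.filter (fun i => x i ≠ z i)).card +
      2 * (Finset.univ.filter (fun i => x i = true ∧ z i = true)).card := by
  simp only [wt, Finset.card_filter, Finset.mul_sum, ← Finset.sum_add_distrib]
  refine Finset.sum_congr rfl fun i _ => ?_
  cases x i <;> cases z i <;> simp

/-- A set of tuples that is closed under XOR of triples and contains all tuples of weight `t`,
where `0 < t < k`, is closed under flipping two distinct coordinates. -/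
lemma xor_pair_mem {k t : ℕ} (ht : 1 ≤ t) (htk : t < k)
    {T : Set (Fin k → Bool)} (hT : InT k t ⊆ T)
    (hclosed : ∀ u ∈ T, ∀ v ∈ T, ∀ w ∈ T, (fun i => xor (u i) (xor (v i) (w i))) ∈ T)
    {x : Fin k → Bool} (hx : x ∈ T) {a b : Fin k} (hab : a ≠ b) :
    (fun i => xor (x i) (decide (i = a ∨ i = b))) ∈ T := by
  obtain ⟨A, haA, hAb, hA⟩ : ∃ A : Finset (Fin k), {a} ⊆ A ∧ A ⊆ Finset.univ.erase b ∧
      A.card = t := by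
    refine Finset.exists_subsuperset_card_eq (by simpa using hab) (by simpa using ht) ?_
    rw [Finset.card_erase_of_mem (Finset.mem_univ b), Finset.card_univ, Fintype.card_fin]
    omega
  have ha : a ∈ A := Finset.singleton_subset_iff.mp haA
  have hb : b ∉ A := fun h => (Finset.mem_erase.mp (hAb h)).1 rfl
  have hB : (insert b (A.erase a)).card = t := by
    rw [Finset.card_insert_of_notMem (by simp [hb]), Finset.card_erase_of_mem ha, hA]
    omega
  convert hclosed x hx _ (hT ((wt_decide_mem A).trans hA)) _
    (hT ((wt_decide_mem (insert b (A.erase a))).trans hB)) using 3 with i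
  by_cases hia : i = a
  · subst hia
    simp [ha, hab]
  · by_cases hib : i = b
    · subst hib
      simp [hb]
    · simp [hia, hib]

/-- A set of tuples closed under flipping two distinct coordinates contains every tuple that
differs from one of its members in an even number of coordinates. -/
lemma mem_of_even_card_ne {k : ℕ} {T : Set (Fin k → Bool)}
    (hflip : ∀ x ∈ T, ∀ a b, a ≠ b → (fun i => xor (x i) (decide (i = a ∨ i = b))) ∈ T)
    (z : Fin k → Bool) (n : ℕ) (x : Fin k → Bool) (hx : x ∈ T)
    (hcard : (Finset.univ.filter (fun i => x i ≠ z i)).card = 2 * n) : z ∈ T := by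
  induction n generalizing x with
  | zero =>
    have h : x = z := by
      funext i
      by_contra hi
      have hmem : i ∈ Finset.univ.filter (fun i => x i ≠ z i) := by simpa using hi
      simp [Finset.card_eq_zero.mp hcard] at hmem
    exact h ▸ hx
  | succ n ih =>
    obtain ⟨a, ha, b, hb, hab⟩ := Finset.one_lt_card.mp
      (show 1 < (Finset.univ.filter (fun i => x i ≠ z i)).card by omega)
    refine ih _ (hflip x hx a b hab) ?_
    have h : Finset.univ.filter (fun i => xor (x i) (decide (i = a ∨ i = b)) ≠ z i) =
        ((Finset.univ.filter (fun i => x i ≠ z i)).erase a).erase b := by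
      ext i
      simp only [Finset.mem_filter, Finset.mem_univ, true_and] at ha hb
      by_cases hia : i = a
      · subst hia
        simpa [Bool.not_eq] using ha
      · by_cases hib : i = b
        · subst hib
          simpa [Bool.not_eq] using hb
        · simp [hia, hib]
    rw [h, Finset.card_erase_of_mem (Finset.mem_erase.mpr ⟨hab.symm, hb⟩),
      Finset.card_erase_of_mem ha]
    omega

theorem stmt_17 {k t : ℕ} (hk : 4 ≤ k) (hkeven : Even k)
    (htodd : Odd t) (ht : 1 ≤ t) (htk : t < k)
    (T : Set (Fin k → Bool)) (hT : InT k t ⊆ T)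
    (hclosed : ∀ u ∈ T, ∀ v ∈ T, ∀ w ∈ T,
      (fun i => xor (u i) (xor (v i) (w i))) ∈ T) :
    ∀ z : Fin k → Bool, Odd (wt z) → z ∈ T := by
  intro z hz
  obtain ⟨A, -, hA⟩ := Finset.exists_subset_card_eq
    (show t ≤ (Finset.univ : Finset (Fin k)).card by simpa using htk.le)
  have hwt := (wt_decide_mem A).trans hA
  have hsum := wt_add_wt (fun i => decide (i ∈ A)) z
  rw [hwt] at hsum
  obtain ⟨p, hp⟩ := htodd
  obtain ⟨q, hq⟩ := hz
  exact mem_of_even_card_ne (fun x hx a b hab => xor_pair_mem ht htk hT hclosed hx hab) z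
    ((Finset.univ.filter (fun i => decide (i ∈ A) ≠ z i)).card / 2) _ (hT hwt) (by omega)
end

section
/- Let k ≥ 3, let t be odd with 1 ≤ t < k, and let d satisfy t < d ≤ k. Then there exist d tuples v_1, …, v_d ∈ {0,1}^k, each of Hamming weight exactly t, whose componentwise mod-2 sum equals the tuple whose first d coordinates are 1 and whose remaining k − d coordinates are 0. -/
/-- Exactly `t` elements of `Fin d` have value below `t`, when `t ≤ d`. -/
theorem card_filter_val_lt_of_le {d t : ℕ} (h : t ≤ d) :
    (Finset.univ.filter (fun x : Fin d => (x : ℕ) < t)).card = t := by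
  simp [Fin.card_filter_val_lt, h]

theorem card_filter_equiv_val_lt {d t : ℕ} (h : t ≤ d) (e : Fin d ≃ Fin d) :
    (Finset.univ.filter (fun x : Fin d => (e x : ℕ) < t)).card = t := by
  rw [← card_filter_val_lt_of_le h]
  exact Finset.card_equiv e (by simp [card_filter_val_lt_of_le h])

theorem stmt_19 {k t d : ℕ} (hk : 3 ≤ k) (htodd : Odd t) (ht : 1 ≤ t) (htk : t < k)
    (htd : t < d) (hdk : d ≤ k) :
    ∃ v : Fin d → Fin k → Bool, (∀ j, wt (v j) = t) ∧
      ∀ i : Fin k,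
        (Odd ((Finset.univ.filter (fun j : Fin d => v j i = true)).card) ↔
          (i : ℕ) < d) := by
  have : NeZero d := ⟨by omega⟩
  -- The rows are the cyclic shifts of a block of `t` ones inside the first `d` coordinates.
  refine ⟨fun j i => decide (∃ h : (i : ℕ) < d, (((⟨i, h⟩ : Fin d) - j : Fin d) : ℕ) < t),
    fun j => ?_, fun i => ?_⟩
  · unfold wt
    refine Eq.trans ?_ (card_filter_equiv_val_lt htd.le (Equiv.subRight j))
    rw [← Finset.card_map (Fin.castLEEmb hdk)]
    congr 1
    ext i
    simp only [Finset.mem_filter, Finset.mem_univ, true_and, decide_eq_true_eq,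
      Finset.mem_map, Equiv.subRight_apply]
    constructor
    · rintro ⟨h, hi⟩
      exact ⟨⟨i, h⟩, hi, rfl⟩
    · rintro ⟨x, hx, rfl⟩
      exact ⟨x.2, hx⟩
  · by_cases h : (i : ℕ) < d
    · have hcard := card_filter_equiv_val_lt htd.le (Equiv.subLeft (⟨i, h⟩ : Fin d))
      simp only [Equiv.subLeft_apply] at hcard
      simp [h, hcard, htodd]
    · simp [h]
end
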